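/- For every t ∈ [0,1] and every local field D (diagonal unitary on H), the one-step commutator with the position operator has norm exactly t: ‖[X, U_{t,D}]‖ = ‖[X, U_t]‖ = t, where U_{t,D} = D·U_t. -/

import Mathlib

noncomputable section

abbrev Hqw : Type := lp (fun _ : ℤ => ℂ) 2
abbrev Op : Type := Hqw →L[ℂ] Hqw

noncomputable def δ (j : ℤ) : Hqw := lp.single 2 j 1

def coord (ψ : Hqw) (i : ℤ) : ℂ := ψ i

/-- `B δ_j = δ_{j-1} - δ_{j+1}`. -/
def IsB (B : Op) : Prop := ∀ j : ℤ, B (δ j) = δ (j - 1) - δ (j + 1)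

/-- `C δ_{2j} = δ_{2j+2}`, `C δ_{2j+1} = δ_{2j-1}`. -/
def IsC (C : Op) : Prop :=
  ∀ j : ℤ, C (δ (2 * j)) = δ (2 * j + 2) ∧ C (δ (2 * j + 1)) = δ (2 * j - 1)

/-- the position sequence: `x_{2j} = x_{2j+1} = |j|`. -/
def IsPos (x : ℤ → ℝ) : Prop :=
  ∀ j : ℤ, x (2 * j) = |(j : ℝ)| ∧ x (2 * j + 1) = |(j : ℝ)|

/-- `K` is the commutator `[X, A]`, i.e. `⟨δ_i, K δ_j⟩ = (x_i - x_j) ⟨δ_i, A δ_j⟩`. -/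
def IsXComm (x : ℤ → ℝ) (A K : Op) : Prop :=
  ∀ i j : ℤ, coord (K (δ j)) i = ((x i - x j : ℝ) : ℂ) * coord (A (δ j)) i

/-- a local field: a diagonal unitary `D δ_j = e^{iθ_j} δ_j`. -/
def IsLocalField (D : Op) : Prop :=
  ∃ θ : ℤ → ℝ, ∀ j : ℤ, D (δ j) = Complex.exp ((θ j : ℂ) * Complex.I) • δ j

/-- `U_t = r² I + r t B + t² C` with `r = √(1 - t²)`. -/
def Ut (t : ℝ) (B C : Op) : Op :=
  (((Real.sqrt (1 - t ^ 2)) ^ 2 : ℝ) : ℂ) • (1 : Op) +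
    ((Real.sqrt (1 - t ^ 2) * t : ℝ) : ℂ) • B + ((t ^ 2 : ℝ) : ℂ) • C

/-- `⟨X⟩_ψ = Σ_j x_j |⟨δ_j, ψ⟩|²`. -/
def Xexp (x : ℤ → ℝ) (ψ : Hqw) : ℝ := ∑' j : ℤ, x j * ‖coord ψ j‖ ^ 2

/-- a unit vector supported on `span{δ₀, δ₁}`. -/
def IsInit (Ψ : Hqw) : Prop := ‖Ψ‖ = 1 ∧ ∃ a b : ℂ, Ψ = a • δ 0 + b • δ 1

/-- `α = e^{2πik/n}` with `k ∈ ℤ⁺`, `gcd(k,n) = 1`, `α ≠ 1`. -/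
def IsAdmissible (n : ℕ) (α : ℂ) : Prop :=
  α ≠ 1 ∧ ∃ k : ℕ, 0 < k ∧ Nat.gcd k n = 1 ∧
    α = Complex.exp (((2 * Real.pi * k / n : ℝ) : ℂ) * Complex.I)

/-- the `n`-periodic field `D_n δ_j = α^j δ_j`. -/
def IsDn (α : ℂ) (D : Op) : Prop := ∀ j : ℤ, D (δ j) = α ^ j • δ j

/-- `B^{(j)} = D_n^j B D_n^{-j}`, explicitly `B^{(j)} δ_i = α^{-j} δ_{i-1} - α^{j} δ_{i+1}`. -/
def IsBj (α : ℂ) (j : ℤ) (Bj : Op) : Prop :=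
  ∀ i : ℤ, Bj (δ i) = α ^ (-j) • δ (i - 1) - α ^ j • δ (i + 1)

/-- `C^{(j)} = D_n^j C D_n^{-j}`, explicitly `C^{(j)} δ_{2i} = α^{2j} δ_{2i+2}`,
`C^{(j)} δ_{2i+1} = α^{-2j} δ_{2i-1}`. -/
def IsCj (α : ℂ) (j : ℤ) (Cj : Op) : Prop :=
  ∀ i : ℤ, Cj (δ (2 * i)) = α ^ (2 * j) • δ (2 * i + 2) ∧
    Cj (δ (2 * i + 1)) = α ^ (-(2 * j)) • δ (2 * i - 1)

-- the elementary symmetric polynomial of operators `S^{ℓ,m}_{[a, n-1]}`: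
-- sum over `a ≤ j₁ < … < j_ℓ ≤ n-1` and `η ∈ {0,1}^ℓ` with `|η| = m` of the ordered
-- products `A_{η₁}^{(j₁)} ⋯ A_{η_ℓ}^{(j_ℓ)}`, where `A_1 = C`, `A_0 = B`.
open Classical in
noncomputable def Sop (Bf Cf : ℤ → Op) (a n ℓ m : ℕ) : Op :=
  ∑ p : (Fin ℓ → Fin n) × (Fin ℓ → Bool),
    if StrictMono p.1 ∧ (∀ k, a ≤ (p.1 k : ℕ)) ∧
        (Finset.univ.filter fun k => p.2 k = true).card = m then
      (List.ofFn fun k : Fin ℓ =>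
        if p.2 k = true then Cf ((p.1 k : ℕ) : ℤ) else Bf ((p.1 k : ℕ) : ℤ)).prod
    else 0

theorem coord_δ (j i : ℤ) : coord (δ j) i = if i = j then 1 else 0 := by
  unfold coord δ
  by_cases h : i = j
  · subst h; simp
  · rw [lp.single_apply_ne _ _ _ h]; simp [h]

theorem coord_add' (u v : Hqw) (i : ℤ) : coord (u + v) i = coord u i + coord v i := rfl
theorem coord_sub' (u v : Hqw) (i : ℤ) : coord (u - v) i = coord u i - coord v i := rfl
theorem coord_smul' (c : ℂ) (v : Hqw) (i : ℤ) : coord (c • v) i = c * coord v i := rfl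

theorem inner_δ_left (i : ℤ) (v : Hqw) : inner ℂ (δ i) v = coord v i := by
  unfold δ coord
  rw [lp.inner_single_left]; simp

theorem ext_δ {F : Type*} [AddCommMonoid F] [Module ℂ F] [TopologicalSpace F] [T2Space F]
    {f g : Hqw →L[ℂ] F} (h : ∀ j, f (δ j) = g (δ j)) : f = g := by
  apply lp.ext_continuousLinearMap (by simp)
  intro i
  ext
  simpa [δ] using h i

theorem norm_of_basis (K : Op) (t : ℝ) (ht : 0 ≤ t)
    (h : ∀ i j, inner ℂ (K (δ i)) (K (δ j)) = if i = j then ((t ^ 2 : ℝ) : ℂ) else 0) :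
    ‖K‖ = t := by
  have h1 : star K * K = ((t ^ 2 : ℝ) : ℂ) • (1 : Op) := by
    apply ext_δ
    intro j
    apply lp.ext
    funext i
    have h2 := h i j
    rw [← ContinuousLinearMap.adjoint_inner_right, inner_δ_left] at h2
    have h3 : coord (((t ^ 2 : ℝ) : ℂ) • δ j) i = if i = j then ((t ^ 2 : ℝ) : ℂ) else 0 := by
      rw [coord_smul', coord_δ]; simp
    exact h2.trans h3.symm
  have hnt : Nontrivial Hqw := ⟨δ 0, 0, fun h0 => by
    have := congrArg (fun v => coord v 0) h0
    simp only [coord_δ] at this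
    simp [coord] at this⟩
  have h4 : ‖K‖ * ‖K‖ = t * t := by
    rw [← CStarRing.norm_star_mul_self, h1, norm_smul, norm_one]
    simp [sq]
  exact (mul_self_inj (norm_nonneg _) ht).1 h4

theorem coord_D (D : Op) (θ : ℤ → ℝ)
    (hD : ∀ j : ℤ, D (δ j) = Complex.exp ((θ j : ℂ) * Complex.I) • δ j) (v : Hqw) (i : ℤ) :
    coord (D v) i = Complex.exp ((θ i : ℂ) * Complex.I) * coord v i := by
  have h : (innerSL ℂ (δ i)).comp D = Complex.exp ((θ i : ℂ) * Complex.I) • innerSL ℂ (δ i) := by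
    apply ext_δ
    intro j
    simp only [ContinuousLinearMap.comp_apply, ContinuousLinearMap.smul_apply, innerSL_apply_apply,
      inner_δ_left, hD, coord_smul', coord_δ, smul_eq_mul]
    by_cases hij : i = j
    · subst hij; rfl
    · simp [hij]
  have h' := DFunLike.congr_fun h v
  simpa only [ContinuousLinearMap.comp_apply, ContinuousLinearMap.smul_apply, innerSL_apply_apply,
      inner_δ_left, smul_eq_mul] using h'

theorem abs_step (m : ℤ) : (|((m + 1 : ℤ) : ℝ)| - |(m : ℝ)|) ^ 2 = 1 := by
  rcases le_or_gt 0 m with h | h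
  · have h0 : (0 : ℝ) ≤ m := by exact_mod_cast h
    push_cast
    rw [abs_of_nonneg h0, abs_of_nonneg (by linarith)]; ring
  · have h0 : (m : ℝ) + 1 ≤ 0 := by exact_mod_cast h
    push_cast
    rw [abs_of_nonpos h0, abs_of_nonpos (by linarith)]; ring

theorem main_norm (t : ℝ) (ht : t ∈ Set.Icc (0 : ℝ) 1)
    (B C : Op) (hB : IsB B) (hC : IsC C)
    (x : ℤ → ℝ) (hx : IsPos x) (e : ℤ → ℂ) (he : ∀ i, star (e i) * e i = 1) (K : Op)
    (hK : ∀ i j, coord (K (δ j)) i = ((x i - x j : ℝ) : ℂ) * (e i * coord (Ut t B C (δ j)) i)) :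
    ‖K‖ = t := by
  obtain ⟨ht0, ht1⟩ := ht
  set r := Real.sqrt (1 - t ^ 2) with hr
  have hr2 : r ^ 2 = 1 - t ^ 2 := Real.sq_sqrt (by nlinarith)
  have hr2c : (r : ℂ) ^ 2 = 1 - (t : ℂ) ^ 2 := by exact_mod_cast hr2
  have hab : ∀ m : ℤ, ∃ a b : ℝ, a ^ 2 = 1 ∧ b ^ 2 = 1 ∧
      x (2 * m + 2) - x (2 * m) = a ∧ x (2 * m - 1) - x (2 * m) = b ∧
      x (2 * m + 1) = x (2 * m) := by
    intro m
    refine ⟨_, _, ?_, ?_, rfl, rfl, ?_⟩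
    · rw [show 2 * m + 2 = 2 * (m + 1) by ring, (hx _).1, (hx _).1]; exact abs_step m
    · rw [show 2 * m - 1 = 2 * (m - 1) + 1 by ring, (hx _).2, (hx _).1]
      have := abs_step (m - 1)
      rw [sub_add_cancel] at this
      rw [← this]; ring
    · rw [(hx _).1, (hx _).2]
  choose a b ha hb hxa hxb hxo using hab
  have hev : ∀ m : ℤ, K (δ (2 * m)) = (e (2 * m - 1) * (b m * (r * t) : ℝ)) • δ (2 * m - 1) +
      (e (2 * m + 2) * (a m * t ^ 2 : ℝ)) • δ (2 * m + 2) := by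
    intro m
    apply lp.ext
    funext i
    change coord _ i = coord _ i
    rw [hK]
    simp only [Ut, ContinuousLinearMap.add_apply, ContinuousLinearMap.smul_apply,
      ContinuousLinearMap.one_apply, hB _, (hC m).1, coord_add', coord_sub', coord_smul', coord_δ]
    rw [← hr]
    by_cases h1 : i = 2 * m - 1
    · subst h1
      rw [hxb]
      simp [show 2 * m - 1 ≠ 2 * m + 1 by omega, show 2 * m - 1 ≠ 2 * m + 2 by omega]
      ring
    by_cases h2 : i = 2 * m + 2
    · subst h2
      rw [hxa]
      simp [show 2 * m + 2 ≠ 2 * m - 1 by omega]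
      ring
    by_cases h3 : i = 2 * m
    · subst h3; simp [show 2 * m ≠ 2 * m - 1 by omega]
    by_cases h4 : i = 2 * m + 1
    · subst h4; simp [hxo, show 2 * m + 1 ≠ 2 * m - 1 by omega]
    simp [h1, h2, h3, h4]
  have hod : ∀ m : ℤ, K (δ (2 * m + 1)) = (e (2 * m - 1) * (b m * t ^ 2 : ℝ)) • δ (2 * m - 1) +
      (e (2 * m + 2) * (- (a m * (r * t)) : ℝ)) • δ (2 * m + 2) := by
    intro m
    apply lp.ext
    funext i
    change coord _ i = coord _ i
    rw [hK]
    simp only [Ut, ContinuousLinearMap.add_apply, ContinuousLinearMap.smul_apply,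
      ContinuousLinearMap.one_apply, hB _, (hC m).2, coord_add', coord_sub', coord_smul', coord_δ]
    rw [← hr, hxo, show 2 * m + 1 - 1 = 2 * m by ring, show 2 * m + 1 + 1 = 2 * m + 2 by ring]
    by_cases h1 : i = 2 * m - 1
    · subst h1
      rw [hxb]
      simp [show 2 * m - 1 ≠ 2 * m + 1 by omega, show 2 * m - 1 ≠ 2 * m + 2 by omega]
      ring
    by_cases h2 : i = 2 * m + 2
    · subst h2
      rw [hxa]
      simp [show 2 * m + 2 ≠ 2 * m - 1 by omega]
      ring
    by_cases h3 : i = 2 * m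
    · subst h3; simp [show 2 * m ≠ 2 * m - 1 by omega]
    by_cases h4 : i = 2 * m + 1
    · subst h4; simp [hxo, show 2 * m + 1 ≠ 2 * m - 1 by omega]
    simp [h1, h2, h3, h4]
  have key : ∀ (m n : ℤ) (p q p' q' : ℝ),
      inner ℂ ((e (2 * m - 1) * (p : ℂ)) • δ (2 * m - 1) + (e (2 * m + 2) * (q : ℂ)) • δ (2 * m + 2))
        ((e (2 * n - 1) * (p' : ℂ)) • δ (2 * n - 1) + (e (2 * n + 2) * (q' : ℂ)) • δ (2 * n + 2))
      = if m = n then ((p * p' + q * q' : ℝ) : ℂ) else 0 := by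
    intro m n p q p' q'
    simp only [inner_add_left, inner_smul_left, inner_δ_left, coord_add', coord_smul', coord_δ,
      map_mul, Complex.conj_ofReal]
    by_cases h : m = n
    · subst h
      have e1 := he (2 * m - 1)
      have e2 := he (2 * m + 2)
      simp only [Complex.star_def] at e1 e2
      simp [show 2 * m - 1 ≠ 2 * m + 2 by omega, show 2 * m + 2 ≠ 2 * m - 1 by omega]
      linear_combination (p * p' : ℂ) * e1 + (q * q' : ℂ) * e2
    · simp [h, show 2 * m - 1 ≠ 2 * n + 2 by omega, show 2 * m + 2 ≠ 2 * n - 1 by omega]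
  apply norm_of_basis K t ht0
  intro i j
  rcases Int.even_or_odd' i with ⟨m, rfl | rfl⟩ <;> rcases Int.even_or_odd' j with ⟨n, rfl | rfl⟩
  · rw [hev, hev, key]
    by_cases h : m = n
    · subst h
      simp only [if_true]
      congr 1
      linear_combination (r * t) ^ 2 * hb m + t ^ 4 * ha m + t ^ 2 * hr2
    · simp [h]
  · rw [hev, hod, key, if_neg (show 2 * m ≠ 2 * n + 1 by omega)]
    by_cases h : m = n
    · subst h
      simp only [if_true]
      norm_cast
      linear_combination (r * t ^ 3) * hb m - (r * t ^ 3) * ha m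
    · simp [h]
  · rw [hod, hev, key, if_neg (show 2 * m + 1 ≠ 2 * n by omega)]
    by_cases h : m = n
    · subst h
      simp only [if_true]
      norm_cast
      linear_combination (r * t ^ 3) * hb m - (r * t ^ 3) * ha m
    · simp [h]
  · rw [hod, hod, key]
    by_cases h : m = n
    · subst h
      simp only [if_true]
      congr 1
      linear_combination (r * t) ^ 2 * ha m + t ^ 4 * hb m + t ^ 2 * hr2
    · simp [h]

/-- for every `t ∈ [0,1]` and every local field `D`,
`‖[X, U_{t,D}]‖ = ‖[X, U_t]‖ = t`. -/
theorem stmt2 (t : ℝ) (ht : t ∈ Set.Icc (0 : ℝ) 1)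
    (B C D : Op) (hB : IsB B) (hC : IsC C) (hD : IsLocalField D)
    (x : ℤ → ℝ) (hx : IsPos x)
    (K1 K2 : Op) (hK1 : IsXComm x (D * Ut t B C) K1) (hK2 : IsXComm x (Ut t B C) K2) :
    ‖K1‖ = ‖K2‖ ∧ ‖K2‖ = t := by
  obtain ⟨θ, hθ⟩ := hD
  have h2 : ‖K2‖ = t := by
    refine main_norm t ht B C hB hC x hx (fun _ => 1) (by simp) K2 ?_
    intro i j
    rw [hK2 i j, one_mul]
  have h1 : ‖K1‖ = t := by
    refine main_norm t ht B C hB hC x hx (fun i => Complex.exp ((θ i : ℂ) * Complex.I)) ?_ K1 ?_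
    · intro i
      rw [Complex.star_def, ← Complex.exp_conj, ← Complex.exp_add]
      simp
    · intro i j
      rw [hK1 i j, ContinuousLinearMap.mul_apply, coord_D D θ hθ]
  exact ⟨h1.trans h2.symm, h2⟩
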